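/- For every fixed integer n ≥ 6 there exist constants c, C > 0 (depending only on n) such that for all integers k ≥ 1, c·k^{n−1} ≤ N_LP(n,k) ≤ C·k^{n−1}. -/

import Mathlib

open Polynomial Set

/-- `IsJacobi α s P` says that `P` is the Jacobi polynomial `P_s^{(α,α)}`:
the unique real polynomial of degree `s` orthogonal to all lower-degree
monomials with respect to the weight `(1 - t²)^α` on `(-1,1)`, normalized by
`P(1) = Γ(s+α+1)/(Γ(α+1)·s!)`. -/
def IsJacobi (α : ℝ) (s : ℕ) (P : Polynomial ℝ) : Prop :=
  P.degree = (s : ℕ) ∧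
  (∀ j < s, (∫ t in (-1 : ℝ)..1, P.eval t * t ^ j * (1 - t ^ 2) ^ α) = 0) ∧
  P.eval 1 = Real.Gamma ((s : ℝ) + α + 1) / (Real.Gamma (α + 1) * (Nat.factorial s : ℝ))

/-- The weight function `w(t) = (1-t²)^{(n-3)/2}`. -/
noncomputable def jWeight (n : ℕ) (t : ℝ) : ℝ := (1 - t ^ 2) ^ (((n : ℝ) - 3) / 2)

/-- `‖P‖₂ = (∫_{-1}^1 P(t)² (1-t²)^{(n-3)/2} dt)^{1/2}`. -/
noncomputable def jNorm (n : ℕ) (P : Polynomial ℝ) : ℝ :=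
  Real.sqrt (∫ t in (-1 : ℝ)..1, (P.eval t) ^ 2 * jWeight n t)

/-- `N_LP(n,k)`: supremum of `1/a₀` over polynomials `F = Σ a_s P_s` with
`F ≥ 0` on `[-1,1]`, `F(1) = 1`, `a₀ > 0`, and `a_s ≤ 0` for `s ≥ k`. -/
noncomputable def NLP (k : ℕ) (P : ℕ → Polynomial ℝ) : ℝ :=
  sSup { y : ℝ | ∃ (m : ℕ) (a : ℕ → ℝ) (F : Polynomial ℝ),
    F = ∑ s ∈ Finset.range (m + 1), Polynomial.C (a s) * P s ∧
    (∀ t ∈ Set.Icc (-1 : ℝ) 1, 0 ≤ F.eval t) ∧ F.eval 1 = 1 ∧ 0 < a 0 ∧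
    (∀ s, k ≤ s → a s ≤ 0) ∧ y = 1 / a 0 }

/-! ### Markov's inequality -/

/-- **Markov's inequality** at the points of the right half of `[-1, 1]`, up to a factor `2`. -/
theorem Polynomial.abs_eval_derivative_le_of_nonneg {N : ℕ} {p : ℝ[X]} {M x : ℝ}
    (hdeg : p.degree ≤ N) (hM : 0 < M) (hp : ∀ t ∈ Icc (-1 : ℝ) 1, |p.eval t| ≤ M)
    (hx0 : 0 ≤ x) (hx1 : x ≤ 1) :
    |(derivative p).eval x| ≤ 2 * (N : ℝ) ^ 2 * M := by
  have key : ∀ q : ℝ[X], q.degree ≤ N → (∀ t ∈ Icc (-1 : ℝ) 1, |q.eval t| ≤ M) →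
      (derivative q).eval x ≤ 2 * (N : ℝ) ^ 2 * M := by
    intro q hq hqM
    set ℓ : ℝ[X] := C ((x + 1) / 2) * X + C ((x - 1) / 2)
    have hℓ1 : ℓ.eval 1 = x := by simp [ℓ]; ring
    have hdeg' : (C M⁻¹ * q.comp ℓ).degree ≤ N := by
      rw [← natDegree_le_iff_degree_le] at hq ⊢
      refine (natDegree_C_mul_le _ _).trans (natDegree_comp_le.trans ?_)
      calc q.natDegree * ℓ.natDegree ≤ N * 1 := Nat.mul_le_mul hq natDegree_linear_le
        _ = N := mul_one N
    have h := Chebyshev.eval_iterate_derivative_le_of_forall_abs_le_one (k := 1) (le_refl (1 : ℝ))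
      hdeg' (fun t ht => by
        have ht' : ℓ.eval t ∈ Icc (-1 : ℝ) 1 := by
          simp only [ℓ, eval_add, eval_mul, eval_C, eval_X, mem_Icc] at ht ⊢
          constructor <;> nlinarith [ht.1, ht.2]
        rw [eval_mul, eval_C, eval_comp, abs_mul, abs_of_pos (inv_pos.2 hM), inv_mul_le_iff₀ hM,
          mul_one]
        exact hqM _ ht')
    rw [Function.iterate_one, Chebyshev.derivative_T_eval_one, derivative_C_mul, derivative_comp,
      eval_mul, eval_C, eval_mul, eval_comp, hℓ1, inv_mul_le_iff₀ hM] at h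
    simp only [ℓ, derivative_add, derivative_mul, derivative_C, derivative_X, eval_C, zero_mul,
      zero_add, mul_one, add_zero, Int.cast_natCast] at h
    by_contra! hlt
    have hpos : 0 ≤ (N : ℝ) ^ 2 * M := by positivity
    nlinarith
  refine abs_le.2 ⟨?_, key p hdeg hp⟩
  have h := key (-p) (by rwa [degree_neg]) (fun t ht => by rw [eval_neg, abs_neg]; exact hp t ht)
  rw [derivative_neg, eval_neg] at h
  linarith

/-- **Markov's inequality** on `[-1, 1]`, up to a factor `2`. -/
theorem Polynomial.abs_eval_derivative_le {N : ℕ} {p : ℝ[X]} {M x : ℝ}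
    (hdeg : p.degree ≤ N) (hM : 0 < M) (hp : ∀ t ∈ Icc (-1 : ℝ) 1, |p.eval t| ≤ M)
    (hx : x ∈ Icc (-1 : ℝ) 1) :
    |(derivative p).eval x| ≤ 2 * (N : ℝ) ^ 2 * M := by
  rcases le_total 0 x with h0 | h0
  · exact abs_eval_derivative_le_of_nonneg hdeg hM hp h0 hx.2
  · have h := abs_eval_derivative_le_of_nonneg (p := p.comp (-X)) (N := N) (x := -x)
      (by
        rw [← natDegree_le_iff_degree_le] at hdeg ⊢
        refine natDegree_comp_le.trans ?_
        simpa using hdeg)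
      hM
      (fun t ht => by
        rw [eval_comp, eval_neg, eval_X]
        exact hp _ ⟨by linarith [ht.2], by linarith [ht.1]⟩)
      (by linarith) (by linarith [hx.1])
    rwa [derivative_comp, eval_mul, eval_comp, derivative_neg, derivative_X, eval_neg, eval_neg,
      eval_one, eval_X, neg_neg, neg_one_mul, abs_neg] at h

theorem Polynomial.abs_eval_sub_eval_le {N : ℕ} {p : ℝ[X]} {M x y : ℝ}
    (hdeg : p.degree ≤ N) (hM : 0 < M) (hp : ∀ t ∈ Icc (-1 : ℝ) 1, |p.eval t| ≤ M)
    (hx : x ∈ Icc (-1 : ℝ) 1) (hy : y ∈ Icc (-1 : ℝ) 1) :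
    |p.eval y - p.eval x| ≤ 2 * (N : ℝ) ^ 2 * M * |y - x| :=
  (convex_Icc (-1 : ℝ) 1).norm_image_sub_le_of_norm_hasDerivWithin_le
    (fun z _ => (p.hasDerivAt z).hasDerivWithinAt)
    (fun _ hz => abs_eval_derivative_le hdeg hM hp hz) hx hy

/-! ### Integration against the ultraspherical weight -/

theorem one_sub_sq_nonneg_of_mem_Icc {t : ℝ} (ht : t ∈ Icc (-1 : ℝ) 1) : 0 ≤ 1 - t ^ 2 := by
  nlinarith [ht.1, ht.2]

theorem continuous_eval_mul_weight {α : ℝ} (hα : 0 ≤ α) (p : ℝ[X]) :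
    Continuous fun t : ℝ => p.eval t * (1 - t ^ 2) ^ α :=
  p.continuous.mul ((continuous_const.sub (continuous_pow 2)).rpow_const fun _ => Or.inr hα)

/-- The functional `p ↦ ∫_{-1}^1 p(t) (1 - t²)^α dt` on polynomials, for `α ≥ 0`. -/
noncomputable def weightedIntegral (α : ℝ) (hα : 0 ≤ α) : ℝ[X] →ₗ[ℝ] ℝ where
  toFun p := ∫ t in (-1 : ℝ)..1, p.eval t * (1 - t ^ 2) ^ α
  map_add' p q := by
    rw [← intervalIntegral.integral_add
      ((continuous_eval_mul_weight hα p).intervalIntegrable _ _)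
      ((continuous_eval_mul_weight hα q).intervalIntegrable _ _)]
    simp only [eval_add, add_mul]
  map_smul' c p := by
    simp only [eval_smul, smul_eq_mul, RingHom.id_apply, mul_assoc,
      intervalIntegral.integral_const_mul]

section weightedIntegral

variable {α : ℝ} (hα : 0 ≤ α)

theorem weightedIntegral_apply (p : ℝ[X]) :
    weightedIntegral α hα p = ∫ t in (-1 : ℝ)..1, p.eval t * (1 - t ^ 2) ^ α := rfl

theorem weightedIntegral_C_mul (c : ℝ) (p : ℝ[X]) :
    weightedIntegral α hα (C c * p) = c * weightedIntegral α hα p := by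
  rw [← smul_eq_C_mul, map_smul, smul_eq_mul]

theorem weightedIntegral_mono {p q : ℝ[X]} (h : ∀ t ∈ Icc (-1 : ℝ) 1, p.eval t ≤ q.eval t) :
    weightedIntegral α hα p ≤ weightedIntegral α hα q :=
  intervalIntegral.integral_mono_on (by norm_num)
    ((continuous_eval_mul_weight hα p).intervalIntegrable _ _)
    ((continuous_eval_mul_weight hα q).intervalIntegrable _ _)
    fun t ht => mul_le_mul_of_nonneg_right (h t ht)
      (Real.rpow_nonneg (one_sub_sq_nonneg_of_mem_Icc ht) α)

theorem weightedIntegral_pos {p : ℝ[X]} (hp : p ≠ 0) (h : ∀ t ∈ Icc (-1 : ℝ) 1, 0 ≤ p.eval t) :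
    0 < weightedIntegral α hα p := by
  obtain ⟨x, hx, hpx⟩ : ∃ x ∈ Ioo (-1 : ℝ) 1, p.eval x ≠ 0 := by
    by_contra! hz
    exact hp (eq_zero_of_infinite_isRoot p ((Ioo_infinite (by norm_num)).mono hz))
  have hxw : 0 < 1 - x ^ 2 := by nlinarith [hx.1, hx.2]
  refine intervalIntegral.integral_pos (by norm_num)
    (continuous_eval_mul_weight hα p).continuousOn
    (fun t ht => mul_nonneg (h t (Ioc_subset_Icc_self ht))
      (Real.rpow_nonneg (one_sub_sq_nonneg_of_mem_Icc (Ioc_subset_Icc_self ht)) α))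
    ⟨x, Ioo_subset_Icc_self hx, mul_pos ?_ (Real.rpow_pos_of_pos hxw α)⟩
  exact (h x (Ioo_subset_Icc_self hx)).lt_of_ne' hpx

/-- **Nikolskii's inequality**: the `L²` norm of a polynomial with respect to the weight
`(1 - t²)^α` controls its sup norm on `[-1, 1]`. -/
theorem sq_eval_le_weightedIntegral {N : ℕ} (hN : 1 ≤ N) {p : ℝ[X]} (hdeg : p.degree ≤ N)
    {t : ℝ} (ht : t ∈ Icc (-1 : ℝ) 1) :
    p.eval t ^ 2 ≤
      32 * (N : ℝ) ^ 2 * (16 * (N : ℝ) ^ 2) ^ α * weightedIntegral α hα (p ^ 2) := by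
  obtain ⟨t₀, ht₀, hmax⟩ := isCompact_Icc.exists_isMaxOn (nonempty_Icc.2 (by norm_num))
    (p.continuous.abs.continuousOn (s := Icc (-1 : ℝ) 1))
  set M := |p.eval t₀|
  have hpM : ∀ s ∈ Icc (-1 : ℝ) 1, |p.eval s| ≤ M := fun s hs => hmax hs
  have hNR : (1 : ℝ) ≤ N := by exact_mod_cast hN
  rcases (abs_nonneg (p.eval t₀)).eq_or_lt with hM0 | hM
  · have h0 : p.eval t = 0 := by
      have := hpM t ht
      rw [show M = 0 from hM0.symm] at this
      exact abs_nonpos_iff.1 this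
    rw [h0, zero_pow two_ne_zero]
    have : 0 ≤ weightedIntegral α hα (p ^ 2) := by
      have := weightedIntegral_mono hα (p := 0) (q := p ^ 2)
        (fun s _ => by rw [eval_zero, eval_pow]; positivity)
      simpa using this
    positivity
  set δ : ℝ := 1 / (4 * (N : ℝ) ^ 2) with hδ
  have hδ0 : 0 < δ := by positivity
  have hδN : δ * (4 * (N : ℝ) ^ 2) = 1 := by rw [hδ]; field_simp
  have hδ1 : δ ≤ 1 / 4 := by
    nlinarith [mul_le_mul_of_nonneg_left (one_le_pow₀ hNR (n := 2)) hδ0.le]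
  obtain ⟨a, b, hab, ha, hb, hI⟩ : ∃ a b : ℝ, b - a = δ / 2 ∧ -1 ≤ a ∧ b ≤ 1 ∧
      ∀ s ∈ Icc a b, |s - t₀| ≤ δ ∧ δ / 4 ≤ 1 - s ^ 2 := by
    rcases le_total 0 t₀ with h0 | h0
    · refine ⟨t₀ - δ, t₀ - δ / 2, by ring, by linarith, by linarith [ht₀.2], fun s hs => ⟨?_, ?_⟩⟩
      · rw [abs_le]; constructor <;> linarith [hs.1, hs.2]
      · nlinarith [hs.1, hs.2, ht₀.2, mul_nonneg (show 0 ≤ 1 - δ / 2 - s by linarith [hs.2, ht₀.2])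
          (show 0 ≤ s + δ by linarith [hs.1])]
    · refine ⟨t₀ + δ / 2, t₀ + δ, by ring, by linarith [ht₀.1], by linarith, fun s hs => ⟨?_, ?_⟩⟩
      · rw [abs_le]; constructor <;> linarith [hs.1, hs.2]
      · nlinarith [hs.1, hs.2, ht₀.1, mul_nonneg (show 0 ≤ 1 - δ / 2 + s by linarith [hs.1, ht₀.1])
          (show 0 ≤ δ - s by linarith [hs.2])]
  have hlow : ∀ s ∈ Icc a b, M ^ 2 / 4 * (δ / 4) ^ α ≤ (p ^ 2).eval s * (1 - s ^ 2) ^ α := by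
    intro s hs
    obtain ⟨h1, h2⟩ := hI s hs
    have hd := abs_eval_sub_eval_le hdeg hM hpM ht₀ (y := s)
      ⟨ha.trans hs.1, hs.2.trans hb⟩
    have hd' : |p.eval s - p.eval t₀| ≤ M / 2 := by
      refine hd.trans ?_
      calc 2 * (N : ℝ) ^ 2 * M * |s - t₀| ≤ 2 * (N : ℝ) ^ 2 * M * δ := by gcongr
        _ = M / 2 * (δ * (4 * (N : ℝ) ^ 2)) := by ring
        _ = M / 2 := by rw [hδN, mul_one]
    have hps : M / 2 ≤ |p.eval s| := by
      have h3 := abs_sub_abs_le_abs_sub (p.eval t₀) (p.eval s)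
      rw [abs_sub_comm] at h3
      have : M - |p.eval s| ≤ M / 2 := h3.trans hd'
      linarith
    rw [eval_pow, ← sq_abs (p.eval s)]
    have : M ^ 2 / 4 ≤ |p.eval s| ^ 2 := by
      calc M ^ 2 / 4 = (M / 2) ^ 2 := by ring
        _ ≤ _ := by gcongr
    gcongr
  have hint : δ / 2 * (M ^ 2 / 4 * (δ / 4) ^ α) ≤ weightedIntegral α hα (p ^ 2) := by
    have hc := continuous_eval_mul_weight hα (p ^ 2)
    calc δ / 2 * (M ^ 2 / 4 * (δ / 4) ^ α) = ∫ _ in a..b, M ^ 2 / 4 * (δ / 4) ^ α := by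
          rw [intervalIntegral.integral_const, hab, smul_eq_mul]
      _ ≤ ∫ s in a..b, (p ^ 2).eval s * (1 - s ^ 2) ^ α :=
          intervalIntegral.integral_mono_on (by linarith)
            intervalIntegrable_const (hc.intervalIntegrable _ _) hlow
      _ ≤ weightedIntegral α hα (p ^ 2) := by
          refine intervalIntegral.integral_mono_interval ha (by linarith) hb ?_
            (hc.intervalIntegrable _ _)
          refine MeasureTheory.ae_restrict_of_forall_mem measurableSet_Ioc fun s hs => ?_
          exact mul_nonneg (by rw [eval_pow]; positivity)
            (Real.rpow_nonneg (one_sub_sq_nonneg_of_mem_Icc (Ioc_subset_Icc_self hs)) α)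
  have hinv : (16 * (N : ℝ) ^ 2) ^ α * (δ / 4) ^ α = 1 := by
    rw [← Real.mul_rpow (by positivity) (by positivity),
      show 16 * (N : ℝ) ^ 2 * (δ / 4) = δ * (4 * (N : ℝ) ^ 2) by ring, hδN, Real.one_rpow]
  calc p.eval t ^ 2 = |p.eval t| ^ 2 := (sq_abs _).symm
    _ ≤ M ^ 2 := by gcongr; exact hpM t ht
    _ = M ^ 2 * (δ * (4 * (N : ℝ) ^ 2)) * ((16 * (N : ℝ) ^ 2) ^ α * (δ / 4) ^ α) := by
        rw [hδN, hinv, mul_one, mul_one]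
    _ = 32 * (N : ℝ) ^ 2 * (16 * (N : ℝ) ^ 2) ^ α * (δ / 2 * (M ^ 2 / 4 * (δ / 4) ^ α)) := by ring
    _ ≤ _ := by gcongr

end weightedIntegral

/-! ### A peaking polynomial -/

/-- The Fejér-type quotient `(1 - T_m) / (m² (1 - X))`: a polynomial of degree less than `m` with
value `1` at `1`, bounded by `1` on `[-1, 1]`, and decaying like `2 / (m² (1 - t))`. -/
theorem exists_fejer_polynomial {m : ℕ} (hm : 1 ≤ m) :
    ∃ A : ℝ[X], A.natDegree ≤ m - 1 ∧ A.eval 1 = 1 ∧ ∀ t ∈ Icc (-1 : ℝ) 1,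
      0 ≤ A.eval t ∧ A.eval t * (1 + (m : ℝ) ^ 2 * (1 - t)) ≤ 3 := by
  have hm0 : (0 : ℝ) < (m : ℝ) ^ 2 := by positivity
  obtain ⟨B, hB⟩ : (X - C (1 : ℝ)) ∣ 1 - Chebyshev.T ℝ m := by
    rw [dvd_iff_isRoot, IsRoot, eval_sub, eval_one, Chebyshev.T_eval_one, sub_self]
  have hBt : ∀ t : ℝ, 1 - (Chebyshev.T ℝ m).eval t = (t - 1) * B.eval t := fun t => by
    simpa using congrArg (eval t) hB
  have hB1 : B.eval 1 = -(m : ℝ) ^ 2 := by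
    have := congrArg (fun q => eval 1 (derivative q)) hB
    simp only [derivative_sub, derivative_one, derivative_mul, derivative_X, derivative_C, eval_sub,
      eval_add, eval_mul, eval_X, eval_C, eval_zero, eval_one, Chebyshev.derivative_T_eval_one,
      Int.cast_natCast] at this
    linarith
  have hBdeg : B.natDegree ≤ m - 1 := by
    rcases eq_or_ne B 0 with rfl | hB0
    · simp
    have h1 : (1 - Chebyshev.T ℝ m).natDegree ≤ m := by
      refine (natDegree_sub_le _ _).trans ?_
      simp [Chebyshev.natDegree_T]
    rw [hB, natDegree_mul (X_sub_C_ne_zero 1) hB0, natDegree_X_sub_C] at h1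
    omega
  refine ⟨C (-((m : ℝ) ^ 2)⁻¹) * B, (natDegree_C_mul_le _ _).trans hBdeg, ?_, fun t ht => ?_⟩
  · rw [eval_mul, eval_C, hB1]
    field_simp
  have hAt : (C (-((m : ℝ) ^ 2)⁻¹) * B).eval t * ((m : ℝ) ^ 2 * (1 - t)) =
      1 - (Chebyshev.T ℝ m).eval t := by
    rw [hBt, eval_mul, eval_C]
    linear_combination (1 - t) * -B.eval t * inv_mul_cancel₀ hm0.ne'
  have hT := Chebyshev.eval_T_real_mem_Icc m ht
  rcases ht.2.eq_or_lt with rfl | hlt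
  · rw [eval_mul, eval_C, hB1]
    constructor
    · rw [neg_mul_neg]
      positivity
    · field_simp
      norm_num
  · have h1t : 0 < 1 - t := by linarith
    have hMVT : 1 - (Chebyshev.T ℝ m).eval t ≤ (m : ℝ) ^ 2 * (1 - t) := by
      have h := (convex_Icc (-1 : ℝ) 1).norm_image_sub_le_of_norm_hasDerivWithin_le
        (C := (m : ℝ) ^ 2)
        (fun z _ => ((Chebyshev.T ℝ m).hasDerivAt z).hasDerivWithinAt)
        (fun z hz => by
          have := Chebyshev.abs_iterate_derivative_T_real_le m 1 (abs_le.2 hz)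
          rwa [Function.iterate_one, Chebyshev.derivative_T_eval_one, Int.cast_natCast] at this)
        ht (right_mem_Icc.2 (by norm_num))
      rw [Chebyshev.T_eval_one, Real.norm_eq_abs, Real.norm_eq_abs, abs_of_pos h1t] at h
      exact (le_abs_self _).trans h
    have hu : 0 < (m : ℝ) ^ 2 * (1 - t) := by positivity
    constructor
    · by_contra! hneg
      nlinarith [hT.2]
    · rw [mul_add, hAt, mul_one]
      have : (C (-((m : ℝ) ^ 2)⁻¹) * B).eval t ≤ 1 := by
        by_contra! hgt
        nlinarith
      linarith [hT.1]

theorem integral_inv_sq_one_add_mul_le {c : ℝ} (hc : 0 < c) :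
    ∫ t in (-1 : ℝ)..1, ((1 + c * (1 - t)) ^ 2)⁻¹ ≤ c⁻¹ := by
  have hpos : ∀ t ∈ uIcc (-1 : ℝ) 1, 0 < 1 + c * (1 - t) := fun t ht => by
    rw [uIcc_of_le (by norm_num)] at ht
    have : 0 ≤ c * (1 - t) := mul_nonneg hc.le (by linarith [ht.2])
    linarith
  have hder : ∀ t ∈ uIcc (-1 : ℝ) 1,
      HasDerivAt (fun t : ℝ => c⁻¹ * (1 + c * (1 - t))⁻¹) (((1 + c * (1 - t)) ^ 2)⁻¹) t := by
    intro t ht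
    have h1 : HasDerivAt (fun t : ℝ => 1 + c * (1 - t)) (-c) t := by
      simpa using (((hasDerivAt_id t).const_sub 1).const_mul c).const_add 1
    refine ((h1.fun_inv (hpos t ht).ne').const_mul c⁻¹).congr_deriv ?_
    rw [neg_neg, div_eq_mul_inv, inv_mul_cancel_left₀ hc.ne']
  rw [intervalIntegral.integral_eq_sub_of_hasDerivAt hder]
  · have := hpos (-1) left_mem_uIcc
    have h2 : 0 ≤ c⁻¹ * (1 + c * (1 - -1))⁻¹ := by positivity
    simpa using h2
  · refine ContinuousOn.intervalIntegrable (ContinuousOn.inv₀ (by fun_prop) fun t ht => ?_)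
    exact (pow_pos (hpos t ht) 2).ne'

theorem weightedIntegral_pow_fejer_le {α : ℝ} (hα : 0 ≤ α) {m r : ℕ} (hm : 1 ≤ m)
    (hr : α + 2 ≤ r) {A : ℝ[X]} (hA : ∀ t ∈ Icc (-1 : ℝ) 1,
      0 ≤ A.eval t ∧ A.eval t * (1 + (m : ℝ) ^ 2 * (1 - t)) ≤ 3) :
    weightedIntegral α hα (A ^ r) ≤ 2 ^ α * 3 ^ r * (((m : ℝ) ^ 2) ^ α * (m : ℝ) ^ 2)⁻¹ := by
  have hm0 : (0 : ℝ) < (m : ℝ) ^ 2 := by positivity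
  have hpt : ∀ t ∈ Icc (-1 : ℝ) 1, (A ^ r).eval t * (1 - t ^ 2) ^ α ≤
      2 ^ α * 3 ^ r * (((m : ℝ) ^ 2) ^ α)⁻¹ * ((1 + (m : ℝ) ^ 2 * (1 - t)) ^ 2)⁻¹ := by
    intro t ht
    obtain ⟨h0, h3⟩ := hA t ht
    have h1t : 0 ≤ 1 - t := by linarith [ht.2]
    set v := 1 + (m : ℝ) ^ 2 * (1 - t) with hv
    have hv1 : 1 ≤ v := by
      have : 0 ≤ (m : ℝ) ^ 2 * (1 - t) := by positivity
      linarith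
    have hv0 : 0 < v := by linarith
    have hw : (1 - t ^ 2) ^ α ≤ 2 ^ α * (((m : ℝ) ^ 2) ^ α)⁻¹ * v ^ α := by
      calc (1 - t ^ 2) ^ α ≤ (2 * (((m : ℝ) ^ 2)⁻¹ * v)) ^ α := by
            refine Real.rpow_le_rpow (one_sub_sq_nonneg_of_mem_Icc ht) ?_ hα
            have : 1 - t ≤ ((m : ℝ) ^ 2)⁻¹ * v := by
              rw [le_inv_mul_iff₀ hm0]
              linarith
            nlinarith [ht.1]
        _ = _ := by
            rw [Real.mul_rpow (by norm_num) (by positivity), Real.mul_rpow (by positivity) hv0.le,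
              Real.inv_rpow hm0.le, mul_assoc]
    have hAr : (A ^ r).eval t ≤ 3 ^ r * (v ^ r)⁻¹ := by
      rw [eval_pow, ← div_eq_mul_inv, ← div_pow]
      exact pow_le_pow_left₀ h0 ((le_div_iff₀ hv0).2 h3) r
    have hexp : v ^ α * (v ^ r)⁻¹ ≤ (v ^ 2)⁻¹ := by
      rw [mul_inv_le_iff₀ (by positivity), le_inv_mul_iff₀ (by positivity), ← Real.rpow_natCast v r,
        ← Real.rpow_natCast v 2, ← Real.rpow_add hv0]
      exact Real.rpow_le_rpow_of_exponent_le hv1 (by push_cast; linarith)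
    calc (A ^ r).eval t * (1 - t ^ 2) ^ α
        ≤ (3 ^ r * (v ^ r)⁻¹) * (2 ^ α * (((m : ℝ) ^ 2) ^ α)⁻¹ * v ^ α) :=
          mul_le_mul hAr hw (Real.rpow_nonneg (one_sub_sq_nonneg_of_mem_Icc ht) α) (by positivity)
      _ = 2 ^ α * 3 ^ r * (((m : ℝ) ^ 2) ^ α)⁻¹ * (v ^ α * (v ^ r)⁻¹) := by ring
      _ ≤ _ := by gcongr
  have hcont : ContinuousOn (fun t : ℝ => 2 ^ α * 3 ^ r * (((m : ℝ) ^ 2) ^ α)⁻¹ *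
      ((1 + (m : ℝ) ^ 2 * (1 - t)) ^ 2)⁻¹) (uIcc (-1) 1) := by
    refine ContinuousOn.mul continuousOn_const (ContinuousOn.inv₀ (by fun_prop) fun t ht => ?_)
    rw [uIcc_of_le (by norm_num)] at ht
    have : 0 ≤ (m : ℝ) ^ 2 * (1 - t) := mul_nonneg hm0.le (by linarith [ht.2])
    positivity
  calc weightedIntegral α hα (A ^ r)
      ≤ ∫ t in (-1 : ℝ)..1, 2 ^ α * 3 ^ r * (((m : ℝ) ^ 2) ^ α)⁻¹ *
          ((1 + (m : ℝ) ^ 2 * (1 - t)) ^ 2)⁻¹ :=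
        intervalIntegral.integral_mono_on (by norm_num)
          ((continuous_eval_mul_weight hα _).intervalIntegrable _ _) hcont.intervalIntegrable hpt
    _ ≤ 2 ^ α * 3 ^ r * (((m : ℝ) ^ 2) ^ α)⁻¹ * ((m : ℝ) ^ 2)⁻¹ := by
        rw [intervalIntegral.integral_const_mul]
        gcongr
        exact integral_inv_sq_one_add_mul_le hm0
    _ = _ := by rw [mul_inv]; ring

/-! ### Jacobi polynomials -/

section Jacobi

variable {α : ℝ} {P : ℕ → ℝ[X]}

theorem IsJacobi.eval_one_pos (hα : 0 ≤ α) {s : ℕ} {p : ℝ[X]} (h : IsJacobi α s p) :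
    0 < p.eval 1 := by
  rw [h.2.2]
  have h1 := Real.Gamma_pos_of_pos (show 0 < (s : ℝ) + α + 1 by positivity)
  have h2 := Real.Gamma_pos_of_pos (show 0 < α + 1 by positivity)
  positivity

theorem IsJacobi.eq_one (hα : 0 ≤ α) {p : ℝ[X]} (h : IsJacobi α 0 p) : p = 1 := by
  have hC := eq_C_of_degree_eq_zero (p := p) (by simpa using h.1)
  have h2 := (Real.Gamma_pos_of_pos (show 0 < α + 1 by positivity)).ne'
  have h1 := h.2.2
  rw [hC, eval_C] at h1
  rw [hC, h1]
  simp [h2]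

theorem IsJacobi.ne_zero {s : ℕ} {p : ℝ[X]} (h : IsJacobi α s p) : p ≠ 0 := by
  rintro rfl
  simpa using h.1

theorem IsJacobi.weightedIntegral_mul_eq_zero (hα : 0 ≤ α) {s : ℕ} {p q : ℝ[X]}
    (h : IsJacobi α s p) (hq : q.degree < s) : weightedIntegral α hα (p * q) = 0 := by
  rw [q.as_sum_range_C_mul_X_pow, Finset.mul_sum, map_sum]
  refine Finset.sum_eq_zero fun j hj => ?_
  rw [mul_left_comm, weightedIntegral_C_mul]
  rcases eq_or_ne (q.coeff j) 0 with h0 | h0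
  · rw [h0, zero_mul]
  · have hjs : j < s := by exact_mod_cast (le_degree_of_ne_zero h0).trans_lt hq
    have := h.2.1 j hjs
    rw [weightedIntegral_apply]
    simp only [eval_mul, eval_pow, eval_X, this, mul_zero]

theorem weightedIntegral_mul_jacobi_of_ne (hα : 0 ≤ α) (hP : ∀ s, IsJacobi α s (P s)) {i j : ℕ}
    (hij : i ≠ j) : weightedIntegral α hα (P i * P j) = 0 := by
  rcases hij.lt_or_gt with h | h
  · rw [mul_comm]
    exact (hP j).weightedIntegral_mul_eq_zero hα (by rw [(hP i).1]; exact_mod_cast h)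
  · exact (hP i).weightedIntegral_mul_eq_zero hα (by rw [(hP j).1]; exact_mod_cast h)

theorem weightedIntegral_jacobi_sq_pos (hα : 0 ≤ α) {s : ℕ} {p : ℝ[X]} (h : IsJacobi α s p) :
    0 < weightedIntegral α hα (p * p) :=
  weightedIntegral_pos hα (mul_ne_zero h.ne_zero h.ne_zero) fun t _ => by
    rw [eval_mul]; exact mul_self_nonneg _

theorem exists_jacobi_expansion (hP : ∀ s, IsJacobi α s (P s)) (k : ℕ) :
    ∀ p : ℝ[X], p.degree < k → ∃ a : ℕ → ℝ, (∀ s, k ≤ s → a s = 0) ∧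
      p = ∑ s ∈ Finset.range k, C (a s) * P s := by
  induction k with
  | zero => exact fun p hp => ⟨0, fun _ _ => rfl, by simpa [Nat.WithBot.lt_zero_iff] using hp⟩
  | succ k ih =>
    intro p hp
    have hlead : (P k).coeff k ≠ 0 := coeff_ne_zero_of_eq_degree (hP k).1
    set c := p.coeff k / (P k).coeff k with hc
    obtain ⟨a, ha, hpa⟩ := ih (p - C c * P k) (by
      rw [degree_lt_iff_coeff_zero]
      intro j hj
      rw [coeff_sub, coeff_C_mul]
      rcases hj.eq_or_lt with rfl | hlt
      · rw [hc, div_mul_cancel₀ _ hlead, sub_self]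
      · rw [(degree_lt_iff_coeff_zero p _).1 hp j hlt,
          coeff_eq_zero_of_degree_lt (by rw [(hP k).1]; exact_mod_cast hlt), mul_zero, sub_zero])
    refine ⟨Function.update a k c, fun s hs => ?_, ?_⟩
    · rw [Function.update_of_ne (by omega)]
      exact ha s (by omega)
    · rw [Finset.sum_range_succ, Function.update_self, ← sub_eq_iff_eq_add, hpa]
      refine Finset.sum_congr rfl fun s hs => ?_
      rw [Function.update_of_ne (Finset.mem_range.1 hs).ne]

theorem weightedIntegral_sum_mul_jacobi (hα : 0 ≤ α) (hP : ∀ s, IsJacobi α s (P s)) (m : ℕ)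
    (a : ℕ → ℝ) (j : ℕ) :
    weightedIntegral α hα ((∑ s ∈ Finset.range m, C (a s) * P s) * P j) =
      if j < m then a j * weightedIntegral α hα (P j * P j) else 0 := by
  rw [Finset.sum_mul, map_sum]
  simp only [mul_assoc, weightedIntegral_C_mul]
  simp only [← Finset.mem_range (n := m)]
  rw [← Finset.sum_ite_eq' (Finset.range m) j fun s => a s * weightedIntegral α hα (P s * P s)]
  refine Finset.sum_congr rfl fun s _ => ?_
  split_ifs with h
  · rw [h]
  · rw [weightedIntegral_mul_jacobi_of_ne hα hP h, mul_zero]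

theorem weightedIntegral_jacobi_sum (hα : 0 ≤ α) (hP : ∀ s, IsJacobi α s (P s)) (m : ℕ)
    (a : ℕ → ℝ) :
    weightedIntegral α hα (∑ s ∈ Finset.range (m + 1), C (a s) * P s) =
      a 0 * weightedIntegral α hα 1 := by
  have h := weightedIntegral_sum_mul_jacobi hα hP (m + 1) a 0
  rwa [(hP 0).eq_one hα, mul_one, mul_one, if_pos m.succ_pos] at h

/-- The reproducing kernel `K_k(1, ·)` at the point `1` for polynomials of degree less than `k`. -/
noncomputable def jacobiKernelOne (α : ℝ) (hα : 0 ≤ α) (P : ℕ → ℝ[X]) (k : ℕ) : ℝ[X] :=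
  ∑ s ∈ Finset.range k, C ((P s).eval 1 / weightedIntegral α hα (P s * P s)) * P s

theorem weightedIntegral_sum_mul_jacobiKernelOne (hα : 0 ≤ α) (hP : ∀ s, IsJacobi α s (P s))
    (k m : ℕ) (a : ℕ → ℝ) :
    weightedIntegral α hα ((∑ s ∈ Finset.range m, C (a s) * P s) * jacobiKernelOne α hα P k) =
      ∑ s ∈ Finset.range m, if s < k then a s * (P s).eval 1 else 0 := by
  rw [Finset.sum_mul, map_sum]
  refine Finset.sum_congr rfl fun s _ => ?_
  rw [mul_assoc, weightedIntegral_C_mul, mul_comm (P s), jacobiKernelOne,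
    weightedIntegral_sum_mul_jacobi hα hP, mul_ite, mul_zero,
    div_mul_cancel₀ _ (weightedIntegral_jacobi_sq_pos hα (hP s)).ne']

theorem eval_jacobiKernelOne_le (hα : 0 ≤ α) (hP : ∀ s, IsJacobi α s (P s)) {k : ℕ} (hk : 1 ≤ k)
    {t : ℝ} (ht : t ∈ Icc (-1 : ℝ) 1) :
    (jacobiKernelOne α hα P k).eval t ≤ 32 * (k : ℝ) ^ 2 * (16 * (k : ℝ) ^ 2) ^ α := by
  set h := jacobiKernelOne α hα P k
  set B := 32 * (k : ℝ) ^ 2 * (16 * (k : ℝ) ^ 2) ^ α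
  have hself : weightedIntegral α hα (h ^ 2) = h.eval 1 := by
    have := weightedIntegral_sum_mul_jacobiKernelOne hα hP k k
      fun s => (P s).eval 1 / weightedIntegral α hα (P s * P s)
    rw [sq]
    refine this.trans ?_
    simp only [h, jacobiKernelOne, eval_finsetSum, eval_mul, eval_C]
    exact Finset.sum_congr rfl fun s hs => if_pos (Finset.mem_range.1 hs)
  have hdeg : h.degree ≤ k := by
    refine (degree_sum_le _ _).trans (Finset.sup_le fun s hs => ?_)
    rw [← natDegree_le_iff_degree_le]
    refine (natDegree_C_mul_le _ _).trans ?_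
    rw [natDegree_eq_of_degree_eq_some (hP s).1]
    exact (Finset.mem_range.1 hs).le
  have hB : 0 ≤ B := by positivity
  have hnik : ∀ s ∈ Icc (-1 : ℝ) 1, h.eval s ^ 2 ≤ B * h.eval 1 := fun s hs => by
    rw [← hself]
    exact sq_eval_le_weightedIntegral hα hk hdeg hs
  have h1 : h.eval 1 ≤ B := by
    by_contra! hlt
    nlinarith [hnik 1 (right_mem_Icc.2 (by norm_num))]
  refine le_of_sq_le_sq ?_ hB
  calc h.eval t ^ 2 ≤ B * h.eval 1 := hnik t ht
    _ ≤ B ^ 2 := by rw [sq]; gcongr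

end Jacobi

/-! ### The linear programming bound -/

/-- The set of values `1 / a₀` over which `NLP k P` is the supremum. -/
def lpValues (k : ℕ) (P : ℕ → ℝ[X]) : Set ℝ :=
  { y : ℝ | ∃ (m : ℕ) (a : ℕ → ℝ) (F : Polynomial ℝ),
    F = ∑ s ∈ Finset.range (m + 1), Polynomial.C (a s) * P s ∧
    (∀ t ∈ Set.Icc (-1 : ℝ) 1, 0 ≤ F.eval t) ∧ F.eval 1 = 1 ∧ 0 < a 0 ∧
    (∀ s, k ≤ s → a s ≤ 0) ∧ y = 1 / a 0 }

section lpValues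

variable {α : ℝ} {P : ℕ → ℝ[X]}

theorem lpValues_le (hα : 0 ≤ α) (hP : ∀ s, IsJacobi α s (P s)) {k : ℕ} (hk : 1 ≤ k) {y : ℝ}
    (hy : y ∈ lpValues k P) :
    y ≤ 32 * (k : ℝ) ^ 2 * (16 * (k : ℝ) ^ 2) ^ α * weightedIntegral α hα 1 := by
  obtain ⟨m, a, F, hF, hF0, hF1, ha0, hak, rfl⟩ := hy
  set B := 32 * (k : ℝ) ^ 2 * (16 * (k : ℝ) ^ 2) ^ α
  rw [div_le_iff₀ ha0]
  calc 1 = ∑ s ∈ Finset.range (m + 1), a s * (P s).eval 1 := by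
        refine hF1.symm.trans ?_
        rw [hF, eval_finsetSum]
        simp only [eval_mul, eval_C]
    _ ≤ ∑ s ∈ Finset.range (m + 1), if s < k then a s * (P s).eval 1 else 0 := by
        refine Finset.sum_le_sum fun s _ => ?_
        split_ifs with h
        · exact le_rfl
        · exact mul_nonpos_of_nonpos_of_nonneg (hak s (not_lt.1 h)) ((hP s).eval_one_pos hα).le
    _ = weightedIntegral α hα (F * jacobiKernelOne α hα P k) := by
        rw [hF, weightedIntegral_sum_mul_jacobiKernelOne hα hP]
    _ ≤ weightedIntegral α hα (C B * F) := by
        refine weightedIntegral_mono hα fun t ht => ?_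
        rw [eval_mul, eval_mul, eval_C, mul_comm]
        exact mul_le_mul_of_nonneg_right (eval_jacobiKernelOne_le hα hP hk ht) (hF0 t ht)
    _ = B * weightedIntegral α hα 1 * a 0 := by
        rw [weightedIntegral_C_mul, hF, weightedIntegral_jacobi_sum hα hP]
        ring

theorem exists_mem_lpValues_ge (hα : 0 ≤ α) (hP : ∀ s, IsJacobi α s (P s)) {r : ℕ}
    (hr : α + 2 ≤ r) {k : ℕ} (hk : 1 ≤ k) :
    ∃ y ∈ lpValues k P, weightedIntegral α hα 1 * (2 ^ α * 3 ^ r)⁻¹ *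
      ((((k : ℝ) / r) ^ 2) ^ α * ((k : ℝ) / r) ^ 2) ≤ y := by
  have hr0 : 0 < r := by
    rw [← Nat.cast_pos (α := ℝ)]
    linarith
  have hrR : (0 : ℝ) < r := by exact_mod_cast hr0
  set m := (k - 1) / r + 1 with hm
  have hm1 : 1 ≤ m := Nat.succ_pos _
  have hrm : r * (m - 1) ≤ k - 1 := Nat.mul_div_le (k - 1) r
  have hkm : (k : ℝ) / r ≤ m := by
    rw [div_le_iff₀ hrR]
    have : k ≤ m * r := by
      have := Nat.lt_mul_div_succ (k - 1) hr0
      rw [mul_comm, hm]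
      omega
    exact_mod_cast this
  obtain ⟨A, hAdeg, hA1, hA⟩ := exists_fejer_polynomial (m := m) hm1
  have hdeg : (A ^ r).degree < (k - 1 + 1 : ℕ) := by
    have h1 : (A ^ r).natDegree ≤ r * (m - 1) :=
      natDegree_pow_le.trans (Nat.mul_le_mul_left r hAdeg)
    refine degree_le_natDegree.trans_lt ?_
    exact_mod_cast Nat.lt_succ_of_le (h1.trans hrm)
  obtain ⟨a, ha, hAa⟩ := exists_jacobi_expansion hP (k - 1 + 1) (A ^ r) hdeg
  have hA0 : ∀ t ∈ Icc (-1 : ℝ) 1, 0 ≤ (A ^ r).eval t := fun t ht => by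
    rw [eval_pow]
    exact pow_nonneg (hA t ht).1 r
  have hAr1 : (A ^ r).eval 1 = 1 := by rw [eval_pow, hA1, one_pow]
  have hW : 0 < weightedIntegral α hα 1 := weightedIntegral_pos hα one_ne_zero fun t _ => by simp
  have hmean : weightedIntegral α hα (A ^ r) = a 0 * weightedIntegral α hα 1 := by
    rw [hAa, weightedIntegral_jacobi_sum hα hP]
  have ha0 : 0 < a 0 := by
    have : 0 < weightedIntegral α hα (A ^ r) := weightedIntegral_pos hα
      (fun h => by rw [h, eval_zero] at hAr1; exact zero_ne_one hAr1) hA0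
    rw [hmean] at this
    exact pos_of_mul_pos_left this hW.le
  refine ⟨1 / a 0, ⟨k - 1, a, A ^ r, hAa, hA0, hAr1, ha0,
    fun s hs => (ha s (by omega)).le, rfl⟩, ?_⟩
  have hle := weightedIntegral_pow_fejer_le hα (m := m) hm1 hr hA
  have hm0 : (0 : ℝ) < m := by exact_mod_cast Nat.succ_pos _
  rw [hmean, ← div_eq_mul_inv, le_div_iff₀ (by positivity)] at hle
  rw [le_div_iff₀ ha0]
  calc weightedIntegral α hα 1 * (2 ^ α * 3 ^ r)⁻¹ *
        ((((k : ℝ) / r) ^ 2) ^ α * ((k : ℝ) / r) ^ 2) * a 0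
      ≤ weightedIntegral α hα 1 * (2 ^ α * 3 ^ r)⁻¹ *
        (((m : ℝ) ^ 2) ^ α * (m : ℝ) ^ 2) * a 0 := by gcongr
    _ = (2 ^ α * 3 ^ r)⁻¹ *
        (a 0 * weightedIntegral α hα 1 * (((m : ℝ) ^ 2) ^ α * (m : ℝ) ^ 2)) := by ring
    _ ≤ (2 ^ α * 3 ^ r)⁻¹ * (2 ^ α * 3 ^ r) := by gcongr
    _ = 1 := inv_mul_cancel₀ (by positivity)

end lpValues

/-- For every fixed `n ≥ 6`, `N_LP(n,k) = Θ(k^{n-1})` as `k → ∞`: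
there are constants `c, C > 0` depending only on `n` with
`c k^{n-1} ≤ N_LP(n,k) ≤ C k^{n-1}` for all `k ≥ 1`. -/
theorem lp_design_theta (n : ℕ) (hn : 6 ≤ n)
    (P : ℕ → Polynomial ℝ) (hP : ∀ s, IsJacobi (((n : ℝ) - 3) / 2) s (P s)) :
    ∃ c C : ℝ, 0 < c ∧ 0 < C ∧ ∀ k : ℕ, 1 ≤ k →
      c * (k : ℝ) ^ (n - 1) ≤ NLP k P ∧ NLP k P ≤ C * (k : ℝ) ^ (n - 1) := by
  have hnR : (6 : ℝ) ≤ n := by exact_mod_cast hn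
  set α : ℝ := ((n : ℝ) - 3) / 2 with hαdef
  have hα : 0 ≤ α := by linarith
  have hW : 0 < weightedIntegral α hα 1 := weightedIntegral_pos hα one_ne_zero fun t _ => by simp
  have hn0 : (0 : ℝ) < n := by linarith
  have hpow : ∀ x : ℝ, 0 < x → (x ^ 2) ^ α * x ^ 2 = x ^ (n - 1) := by
    intro x hx
    rw [← Real.rpow_natCast x 2, ← Real.rpow_mul hx.le, ← Real.rpow_add hx,
      ← Real.rpow_natCast x (n - 1), Nat.cast_sub (by omega)]
    congr 1
    push_cast
    rw [hαdef]
    ring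
  refine ⟨weightedIntegral α hα 1 * (2 ^ α * 3 ^ n)⁻¹ * ((n : ℝ) ^ (n - 1))⁻¹,
    32 * 16 ^ α * weightedIntegral α hα 1, by positivity, by positivity, fun k hk => ?_⟩
  have hk0 : (0 : ℝ) < k := by exact_mod_cast hk
  obtain ⟨y, hy, hyge⟩ := exists_mem_lpValues_ge hα hP (r := n) (by linarith) hk
  have hle : ∀ z ∈ lpValues k P,
      z ≤ 32 * 16 ^ α * weightedIntegral α hα 1 * (k : ℝ) ^ (n - 1) := fun z hz => by
    refine (lpValues_le hα hP hk hz).trans_eq ?_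
    rw [← hpow k hk0, Real.mul_rpow (by norm_num) (by positivity)]
    ring
  refine ⟨le_trans (le_of_eq ?_) (hyge.trans (le_csSup ⟨_, hle⟩ hy)), csSup_le ⟨y, hy⟩ hle⟩
  rw [hpow _ (by positivity), div_pow]
  ring
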